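/- arXiv:math/0605056 — 2 statements merged into one kernel-verified Lean document; each statement's English description precedes it below -/
import Mathlib

section
/- Let k ≥ 2 and let U ⊂ V(C_n^g ≀ Z/2Z) satisfy |∂_≀U|/|U| ≤ 1/(1000k). Then, writing φ = Fol_{C_n^g}^{C^g}: (i) the proportion of bad points of U is at most 1/(1000k), i.e. |{u ∈ U : u bad}|/|U| ≤ 1/(1000k); and (ii) the proportion of points of U that are φ(k)/3-non-satisfiable is at most 1/500, i.e. |{u ∈ U : u ∈ NS^p(φ(k)/3)}|/|U| ≤ 1/500. -/
open MeasureTheory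
open scoped ENNReal

namespace Perco

/-- Vertices of the lattice `Z^d`. -/
abbrev Zd (d : ℕ) := Fin d → ℤ

/-- A percolation configuration: each (unordered) edge of the lattice is open or closed.
(Only the values on nearest-neighbour pairs matter.) -/
abbrev Config (d : ℕ) := Sym2 (Zd d) → Bool

/-- Lattice adjacency: `(x,y) ∈ E^d`. -/
def latAdj {d : ℕ} (x y : Zd d) : Prop := (∑ i, |x i - y i|) = 1

/-- Open adjacency in the configuration `ω`. -/
def openAdj {d : ℕ} (ω : Config d) (x y : Zd d) : Prop :=
  latAdj x y ∧ ω s(x, y) = true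

/-- `C`: the open cluster of the origin. -/
def cluster {d : ℕ} (ω : Config d) : Set (Zd d) :=
  {y | Relation.ReflTransGen (openAdj ω) 0 y}

/-- `Q` is the product measure making the edge states i.i.d. Bernoulli(p). -/
def IsBernoulli {d : ℕ} (p : ℝ) (Q : Measure (Config d)) : Prop :=
  IsProbabilityMeasure Q ∧
    ∀ (s : Finset (Sym2 (Zd d))) (f : Sym2 (Zd d) → Bool),
      Q {ω : Config d | ∀ e ∈ s, ω e = f e} =
        ∏ e ∈ s, (if f e then ENNReal.ofReal p else ENNReal.ofReal (1 - p))

/-- The critical probability `p_c`. -/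
noncomputable def pc (d : ℕ) : ℝ :=
  sSup {p : ℝ | 0 ≤ p ∧ p ≤ 1 ∧
    ∀ Q : Measure (Config d), IsBernoulli p Q → Q {ω | (cluster ω).Infinite} = 0}

/-- The box `B_n = [-n,n]^d`. -/
def box (d n : ℕ) : Set (Zd d) := {x | ∀ i, |x i| ≤ (n : ℤ)}

/-- `C_n`: the connected component of `0` in `C ∩ B_n`. -/
def clusterN {d : ℕ} (ω : Config d) (n : ℕ) : Set (Zd d) :=
  {y | Relation.ReflTransGen
    (fun a b => openAdj ω a b ∧ a ∈ box d n ∧ b ∈ box d n) 0 y}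

/-- `A` is connected in the open subgraph. -/
def ConnOpen {d : ℕ} (ω : Config d) (A : Set (Zd d)) : Prop :=
  ∀ x ∈ A, ∀ y ∈ A,
    Relation.ReflTransGen (fun a b => openAdj ω a b ∧ a ∈ A ∧ b ∈ A) x y

/-- `A` is connected in the lattice. -/
def ConnLat {d : ℕ} (A : Set (Zd d)) : Prop :=
  ∀ x ∈ A, ∀ y ∈ A,
    Relation.ReflTransGen (fun a b => latAdj a b ∧ a ∈ A ∧ b ∈ A) x y

/-- The boundary `∂_{C^g} A` = open lattice edges from `A` to its complement. -/
def bdry {d : ℕ} (ω : Config d) (A : Set (Zd d)) : Set (Zd d × Zd d) :=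
  {e | openAdj ω e.1 e.2 ∧ e.1 ∈ A ∧ e.2 ∉ A}

/-- The profile `f_c` (at scale `n`, exponent `γ`). -/
noncomputable def fcut (d : ℕ) (γ c : ℝ) (n : ℕ) (x : ℝ) : ℝ :=
  if x < c * (n : ℝ) ^ γ then 1 else x ^ (1 - 1 / (d : ℝ))

/-- `ν(x)`: number of open neighbours of `x`. -/
noncomputable def nu {d : ℕ} (ω : Config d) (x : Zd d) : ℕ :=
  Set.ncard {y | openAdj ω x y}

-- Transition kernel of the simple random walk on the open subgraph.
open Classical in
noncomputable def step {d : ℕ} (ω : Config d) (x y : Zd d) : ℝ :=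
  if openAdj ω x y then ((nu ω x : ℝ))⁻¹ else 0

/-- Weight of a path of length `n`. -/
noncomputable def pathW {d n : ℕ} (ω : Config d) (γ : Fin (n + 1) → Zd d) : ℝ :=
  ∏ i : Fin n, step ω (γ i.castSucc) (γ i.succ)

/-- `N_n`: number of distinct sites visited by the path. -/
noncomputable def visits {d n : ℕ} (γ : Fin (n + 1) → Zd d) : ℕ :=
  (Set.range γ).ncard

/-- `P_0^ω(E)`, the probability of a path event for the walk started at 0. -/
noncomputable def PWalk {d : ℕ} (ω : Config d) (n : ℕ)
    (E : (Fin (n + 1) → Zd d) → Prop) : ℝ :=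
  ∑' γ : Fin (n + 1) → Zd d,
    Set.indicator {γ | γ 0 = 0 ∧ E γ} (fun γ => pathW ω γ) γ

/-- `E_0^ω(α^{N_n})`. -/
noncomputable def LaplaceN {d : ℕ} (ω : Config d) (α : ℝ) (n : ℕ) : ℝ :=
  ∑' γ : Fin (n + 1) → Zd d,
    Set.indicator {γ | γ 0 = 0} (fun γ => pathW ω γ * α ^ visits γ) γ

/-- `E_0^ω(α^{N_n} 1_{X_n = 0})`. -/
noncomputable def LaplaceNReturn {d : ℕ} (ω : Config d) (α : ℝ) (n : ℕ) : ℝ :=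
  ∑' γ : Fin (n + 1) → Zd d,
    Set.indicator {γ | γ 0 = 0 ∧ γ (Fin.last n) = 0}
      (fun γ => pathW ω γ * α ^ visits γ) γ

/-- Vertices of the wreath product `C^g ≀ Z/2Z` (lamplighter states). -/
abbrev Lamp (d : ℕ) := Zd d × (Zd d →₀ ZMod 2)

/-- Flip a lamp configuration at one point. -/
noncomputable def flipAt {σ : Type*} (f : σ →₀ ZMod 2) (x : σ) : σ →₀ ZMod 2 :=
  f + Finsupp.single x 1

/-- Transition kernel of the lamplighter walk `Z` with parameter `α`. -/
noncomputable def ptilde {d : ℕ} (ω : Config d) (α : ℝ) (u v : Lamp d) : ℝ :=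
  Set.indicator
    {q : Lamp d × Lamp d | ∀ x, x ≠ q.1.1 → x ≠ q.2.1 → q.1.2 x = q.2.2 x}
    (fun q => (if q.2.2 q.1.1 = 0 then α else 1 - α) *
      (if q.2.2 q.2.1 = 0 then α else 1 - α) * step ω q.1.1 q.2.1) (u, v)

/-- `P̃_o^ω(Z_n = o)`: return probability of the lamplighter walk. -/
noncomputable def ZReturn {d : ℕ} (ω : Config d) (α : ℝ) (n : ℕ) : ℝ :=
  ∑' γ : Fin (n + 1) → Lamp d,
    Set.indicator {γ | γ 0 = (0, 0) ∧ γ (Fin.last n) = (0, 0)}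
      (fun γ => ∏ i : Fin n, ptilde ω α (γ i.castSucc) (γ i.succ)) γ

/-- Vertex set of the wreath product over a vertex set `V` of the base. -/
def wVert {d : ℕ} (V : Set (Zd d)) : Set (Lamp d) :=
  {u | u.1 ∈ V ∧ ↑u.2.support ⊆ V}

/-- Adjacency in the wreath product `C^g ≀ Z/2Z`. -/
def wAdj {d : ℕ} (ω : Config d) (u v : Lamp d) : Prop :=
  (u.1 = v.1 ∧ (∀ x, x ≠ u.1 → u.2 x = v.2 x) ∧ u.2 u.1 ≠ v.2 u.1) ∨
    (u.2 = v.2 ∧ openAdj ω u.1 v.1)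

/-- Boundary of `U` in the wreath product `C^g ≀ Z/2Z`. -/
def wBdry {d : ℕ} (ω : Config d) (U : Set (Lamp d)) : Set (Lamp d × Lamp d) :=
  {e | e.1 ∈ U ∧ e.2 ∈ wVert (cluster ω) \ U ∧ wAdj ω e.1 e.2}

/-- Følner function `Fol_{C_n^g}^{C^g}` (with value `⊤` when no set qualifies). -/
noncomputable def FolC {d : ℕ} (ω : Config d) (n : ℕ) (k : ℝ) : ℝ≥0∞ :=
  sInf {m : ℝ≥0∞ | ∃ A : Set (Zd d), A ⊆ clusterN ω n ∧ A.Nonempty ∧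
    ((bdry ω A).ncard : ℝ) / (A.ncard : ℝ) ≤ 1 / k ∧ m = (A.ncard : ℝ≥0∞)}

/-- Følner function `Fol_{C_n^g ≀ Z/2Z}^{C^g ≀ Z/2Z}`. -/
noncomputable def FolW {d : ℕ} (ω : Config d) (n : ℕ) (k : ℝ) : ℝ≥0∞ :=
  sInf {m : ℝ≥0∞ | ∃ U : Set (Lamp d), U ⊆ wVert (clusterN ω n) ∧ U.Nonempty ∧
    ((wBdry ω U).ncard : ℝ) / (U.ncard : ℝ) ≤ 1 / k ∧ m = (U.ncard : ℝ≥0∞)}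

/-- Degree of a configuration `f` in the graph `K_U`. -/
noncomputable def Kdeg {d : ℕ} (U : Set (Lamp d)) (f : Zd d →₀ ZMod 2) : ℕ :=
  Set.ncard {g : Zd d →₀ ZMod 2 | ∃ x : Zd d, (x, f) ∈ U ∧ (x, g) ∈ U ∧ g = flipAt f x}

/-- A point `u = (x,f)` of `U` is bad if `(x, f̄_x) ∉ U`. -/
def badPt {d : ℕ} (U : Set (Lamp d)) (u : Lamp d) : Prop :=
  (u.1, flipAt u.2 u.1) ∉ U

/-- `D(0,x) ≤ r`: the chemical distance from the origin to `x` is at most `r`. -/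
def chemLE {d : ℕ} (ω : Config d) (x : Zd d) (r : ℕ) : Prop :=
  ∃ m ≤ r, ∃ γ : ℕ → Zd d, γ 0 = 0 ∧ γ m = x ∧ ∀ i < m, openAdj ω (γ i) (γ (i + 1))

/-- `B_r(C)`: chemical ball of radius `r` around the origin. -/
def chemBall {d : ℕ} (ω : Config d) (r : ℕ) : Set (Zd d) := {x | chemLE ω x r}

/-- Lattice connected component of `x` inside a vertex set `V`. -/
def latCompIn {d : ℕ} (V : Set (Zd d)) (x : Zd d) : Set (Zd d) :=
  {y | Relation.ReflTransGen (fun a b => latAdj a b ∧ a ∈ V ∧ b ∈ V) x y}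

/-- Open connected component of `x` inside a vertex set `V`. -/
def openCompIn {d : ℕ} (ω : Config d) (V : Set (Zd d)) (x : Zd d) : Set (Zd d) :=
  {y | Relation.ReflTransGen (fun a b => openAdj ω a b ∧ a ∈ V ∧ b ∈ V) x y}

/-- `L_n`: a connected component of the open subgraph inside `B_n` of maximal cardinality. -/
def IsLargestComp {d : ℕ} (ω : Config d) (n : ℕ) (L : Set (Zd d)) : Prop :=
  (∃ x ∈ box d n, L = openCompIn ω (box d n) x) ∧
    ∀ y ∈ box d n, (openCompIn ω (box d n) y).ncard ≤ L.ncard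

/-- `\bar L`: the connected component of `L` in the full open subgraph. -/
def closureOf {d : ℕ} (ω : Config d) (L : Set (Zd d)) : Set (Zd d) :=
  {y | ∃ x ∈ L, Relation.ReflTransGen (openAdj ω) x y}

/-- The boundary `∂_{\bar L_n^g} A`. -/
def bdryBar {d : ℕ} (ω : Config d) (n : ℕ) (L A : Set (Zd d)) : Set (Zd d × Zd d) :=
  {e | openAdj ω e.1 e.2 ∧ e.1 ∈ A ∩ closureOf ω L ∧ e.2 ∈ box d (n + 1) \ A}

/-- `n(A)`: number of connected components of `B_n − L` containing a component of `A`. -/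
noncomputable def nComp {d : ℕ} (n : ℕ) (L A : Set (Zd d)) : ℕ :=
  Set.ncard {P : Set (Zd d) |
    (∃ x ∈ box d n \ L, P = latCompIn (box d n \ L) x) ∧
    ∃ x ∈ A, latCompIn A x ⊆ P}

/-- The killed kernel `P^{B_r(C)}` acting on functions. -/
noncomputable def Pball {d : ℕ} (ω : Config d) (r : ℕ) (f : Zd d → ℝ) : Zd d → ℝ :=
  Set.indicator (chemBall ω r) (fun x =>
    ∑' y : Zd d, Set.indicator (chemBall ω r) (fun y => step ω x y * f y) y)

/-- The Dirichlet form `ξ(f,f) = ((Id − P^{B_r(C)}) 1_{B_r(C)} f | f)_ν`. -/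
noncomputable def dirichletForm {d : ℕ} (ω : Config d) (r : ℕ) (f : Zd d → ℝ) : ℝ :=
  ∑' x : Zd d, (nu ω x : ℝ) * f x *
    (Set.indicator (chemBall ω r) f x - Pball ω r (Set.indicator (chemBall ω r) f) x)

/-- `‖f‖²_{l²(ν)}`. -/
noncomputable def normSq {d : ℕ} (ω : Config d) (f : Zd d → ℝ) : ℝ :=
  ∑' x : Zd d, (nu ω x : ℝ) * f x ^ 2

/-- `λ_1(B_r(C))`: smallest Dirichlet eigenvalue of the killed walk. -/
noncomputable def lambda1 {d : ℕ} (ω : Config d) (r : ℕ) : ℝ :=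
  sInf {t : ℝ | ∃ f : Zd d → ℝ, f ≠ 0 ∧ Function.support f ⊆ chemBall ω r ∧
    t = dirichletForm ω r f / normSq ω f}

theorem clusterN_subset_box {d : ℕ} (ω : Config d) (n : ℕ) : clusterN ω n ⊆ box d n := by
  intro y hy
  rcases Relation.ReflTransGen.cases_tail hy with h | ⟨z, -, hz⟩
  · subst h
    intro i
    simp
  · exact hz.2.2

theorem clusterN_subset_cluster {d : ℕ} (ω : Config d) (n : ℕ) : clusterN ω n ⊆ cluster ω :=
  fun _ hy => Relation.ReflTransGen.mono (fun _ _ h => h.1) _ _ hy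

theorem box_finite (d n : ℕ) : (box d n).Finite :=
  (Set.finite_Icc (fun _ : Fin d => -(n : ℤ)) (fun _ => (n : ℤ))).subset fun _ hx =>
    ⟨fun i => (abs_le.1 (hx i)).1, fun i => (abs_le.1 (hx i)).2⟩

theorem wVert_finite {d : ℕ} {V : Set (Zd d)} (hV : V.Finite) : (wVert V).Finite := by
  classical
  refine ((hV.prod (Finset.finite_toSet
    (hV.toFinset.finsupp fun _ => (Finset.univ : Finset (ZMod 2)))))).subset ?_
  rintro ⟨x, f⟩ ⟨hx, hf⟩
  refine ⟨hx, ?_⟩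
  simp only [Finset.mem_coe, Finset.mem_finsupp_iff, Finset.mem_univ, implies_true, and_true]
  intro y hy
  exact hV.mem_toFinset.2 (hf hy)

theorem wVert_mono {d : ℕ} {V W : Set (Zd d)} (h : V ⊆ W) : wVert V ⊆ wVert W :=
  fun _ hu => ⟨h hu.1, hu.2.trans h⟩

theorem box_mono {d m n : ℕ} (h : m ≤ n) : box d m ⊆ box d n :=
  fun _ hx i => (hx i).trans (by exact_mod_cast h)

theorem mem_box_succ_of_latAdj {d n : ℕ} {x y : Zd d} (hx : x ∈ box d n) (h : latAdj x y) :
    y ∈ box d (n + 1) := by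
  intro i
  have h1 : |x i - y i| ≤ 1 := by
    have h2 := Finset.single_le_sum (f := fun i => |x i - y i|) (fun j _ => abs_nonneg _)
      (Finset.mem_univ i)
    unfold latAdj at h
    rw [h] at h2
    exact h2
  have h3 := abs_le.1 (hx i)
  have h4 := abs_le.1 h1
  rw [abs_le]
  push_cast
  constructor <;> linarith [h3.1, h3.2, h4.1, h4.2]

theorem wVert_finite_of_subset {d : ℕ} {ω : Config d} {n : ℕ} {U : Set (Lamp d)}
    (hU : U ⊆ wVert (clusterN ω n)) : U.Finite :=
  (wVert_finite ((box_finite d n).subset (clusterN_subset_box ω n))).subset hU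

theorem wBdry_finite {d : ℕ} {ω : Config d} {n : ℕ} {U : Set (Lamp d)}
    (hU : U ⊆ wVert (clusterN ω n)) : (wBdry ω U).Finite := by
  refine ((wVert_finite_of_subset hU).prod (wVert_finite (box_finite d (n + 1)))).subset ?_
  rintro ⟨⟨x, f⟩, ⟨y, g⟩⟩ ⟨hu, -, hadj⟩
  refine ⟨hu, ?_⟩
  obtain ⟨hx, hf⟩ := wVert_mono (clusterN_subset_box ω n) (hU hu)
  dsimp only at hx hf hadj
  rcases hadj with ⟨h1, h2, -⟩ | ⟨h1, h2⟩
  · dsimp only at h1 h2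
    subst h1
    refine ⟨box_mono n.le_succ hx, fun z hz => box_mono n.le_succ ?_⟩
    by_cases hzx : z = x
    · exact hzx ▸ hx
    · refine hf ?_
      simp only [Finset.mem_coe, Finsupp.mem_support_iff] at hz ⊢
      rwa [h2 z hzx]
  · dsimp only at h1 h2
    subst h1
    exact ⟨mem_box_succ_of_latAdj hx h2.1, hf.trans (box_mono n.le_succ)⟩

theorem flipAt_apply_of_ne {σ : Type*} (f : σ →₀ ZMod 2) {x y : σ} (h : y ≠ x) :
    flipAt f x y = f y := by
  simp [flipAt, Finsupp.single_eq_of_ne h]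

theorem flipAt_apply_self {σ : Type*} (f : σ →₀ ZMod 2) (x : σ) :
    flipAt f x x = f x + 1 := by
  simp [flipAt]

theorem flipAt_injective {σ : Type*} (f : σ →₀ ZMod 2) : Function.Injective (flipAt f) := by
  intro x y h
  exact Finsupp.single_left_injective one_ne_zero (add_left_cancel h)

theorem flip_mem_wBdry {d : ℕ} {ω : Config d} {n : ℕ} {U : Set (Lamp d)}
    (hU : U ⊆ wVert (clusterN ω n)) {u : Lamp d} (hu : u ∈ U) (hb : badPt U u) :
    (u, (u.1, flipAt u.2 u.1)) ∈ wBdry ω U := by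
  obtain ⟨hx, hf⟩ := wVert_mono (clusterN_subset_cluster ω n) (hU hu)
  refine ⟨hu, ⟨⟨hx, fun z hz => ?_⟩, hb⟩, Or.inl ⟨rfl, fun z hz => ?_, ?_⟩⟩
  · by_cases hzx : z = u.1
    · exact hzx ▸ hx
    · refine hf ?_
      simp only [Finset.mem_coe, Finsupp.mem_support_iff] at hz ⊢
      rwa [flipAt_apply_of_ne _ hzx] at hz
  · exact (flipAt_apply_of_ne _ hz).symm
  · dsimp only
    rw [flipAt_apply_self]
    simp

theorem ncard_bad_le {d : ℕ} {ω : Config d} {n : ℕ} {U : Set (Lamp d)}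
    (hU : U ⊆ wVert (clusterN ω n)) :
    ({u ∈ U | badPt U u}).ncard ≤ (wBdry ω U).ncard :=
  Set.ncard_le_ncard_of_injOn (fun u => (u, (u.1, flipAt u.2 u.1)))
    (fun _ hu => flip_mem_wBdry hU hu.1 hu.2) (fun _ _ _ _ h => congrArg Prod.fst h)
    (wBdry_finite hU)

theorem Kdeg_eq_ncard_good {d : ℕ} (U : Set (Lamp d)) (f : Zd d →₀ ZMod 2) :
    Kdeg U f = ({x | (x, f) ∈ U ∧ (x, flipAt f x) ∈ U}).ncard := by
  rw [← Set.ncard_image_of_injective _ (flipAt_injective f), Kdeg]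
  congr 1
  ext g
  constructor
  · rintro ⟨x, h1, h2, rfl⟩
    exact ⟨x, ⟨h1, h2⟩, rfl⟩
  · rintro ⟨x, ⟨h1, h2⟩, rfl⟩
    exact ⟨x, h1, h2, rfl⟩

theorem ncard_slice_bad_le {d : ℕ} {ω : Config d} {n : ℕ} {U : Set (Lamp d)}
    (hU : U ⊆ wVert (clusterN ω n)) (f : Zd d →₀ ZMod 2) :
    ({x | (x, f) ∈ U ∧ (x, flipAt f x) ∉ U}).ncard ≤
      ({e ∈ wBdry ω U | e.1.2 = f}).ncard :=
  Set.ncard_le_ncard_of_injOn (fun x => ((x, f), (x, flipAt f x)))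
    (fun _ hx => ⟨flip_mem_wBdry hU hx.1 hx.2, rfl⟩)
    (fun _ _ _ _ h => congrArg (fun e => e.1.1) h) ((wBdry_finite hU).subset (Set.sep_subset _ _))

theorem ncard_bdry_slice_le {d : ℕ} {ω : Config d} {n : ℕ} {U : Set (Lamp d)}
    (hU : U ⊆ wVert (clusterN ω n)) (f : Zd d →₀ ZMod 2) :
    (bdry ω {x | (x, f) ∈ U}).ncard ≤ ({e ∈ wBdry ω U | e.1.2 = f}).ncard := by
  refine Set.ncard_le_ncard_of_injOn (fun e => ((e.1, f), (e.2, f))) ?_ ?_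
    ((wBdry_finite hU).subset (Set.sep_subset _ _))
  · rintro ⟨x, y⟩ ⟨h1, h2, h3⟩
    obtain ⟨hx, hf⟩ := wVert_mono (clusterN_subset_cluster ω n) (hU h2)
    exact ⟨⟨h2, ⟨⟨Relation.ReflTransGen.tail hx h1, hf⟩, h3⟩, Or.inr ⟨rfl, h1⟩⟩, rfl⟩
  · rintro ⟨x, y⟩ - ⟨x', y'⟩ - h
    simp only [Prod.mk.injEq, and_true] at h
    exact Prod.ext h.1 h.2

/-- A non-satisfiable slice of `U` is controlled by the part of the wreath product boundary
lying above its configuration. -/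
theorem ncard_slice_le_of_Kdeg_lt {d : ℕ} {ω : Config d} {n : ℕ} {k : ℝ} (hk : 2 ≤ k)
    {U : Set (Lamp d)} (hU : U ⊆ wVert (clusterN ω n)) {f : Zd d →₀ ZMod 2}
    (hf : (Kdeg U f : ℝ≥0∞) < FolC ω n k / 3) :
    (({x | (x, f) ∈ U}).ncard : ℝ) ≤ k * (({e ∈ wBdry ω U | e.1.2 = f}).ncard : ℝ) := by
  set A : Set (Zd d) := {x | (x, f) ∈ U} with hA
  have hAfin : A.Finite := (wVert_finite_of_subset hU).preimage
    (fun _ _ _ _ h => congrArg Prod.fst h)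
  rcases A.eq_empty_or_nonempty with hemp | hne
  · rw [hemp, Set.ncard_empty]
    push_cast
    positivity
  have hpos : (0 : ℝ) < A.ncard := by exact_mod_cast (Set.ncard_pos hAfin).2 hne
  by_cases hlt : (A.ncard : ℝ≥0∞) < FolC ω n k
  · have hratio : ¬ ((bdry ω A).ncard : ℝ) / (A.ncard : ℝ) ≤ 1 / k := fun h =>
      absurd hlt (not_lt.2 (sInf_le ⟨A, fun x hx => (hU hx).1, hne, h, rfl⟩))
    rw [not_le, div_lt_div_iff₀ (by linarith) hpos] at hratio
    have hle : ((bdry ω A).ncard : ℝ) ≤ (({e ∈ wBdry ω U | e.1.2 = f}).ncard : ℝ) := by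
      exact_mod_cast ncard_bdry_slice_le hU f
    nlinarith
  · rw [not_lt] at hlt
    have hgood : 3 * Kdeg U f ≤ A.ncard := by
      have h1 : (Kdeg U f : ℝ≥0∞) * 3 ≤ A.ncard :=
        (ENNReal.mul_le_of_le_div hf.le).trans hlt
      have h2 : Kdeg U f * 3 ≤ A.ncard := by exact_mod_cast h1
      linarith
    have hsplit : Kdeg U f + ({x | (x, f) ∈ U ∧ (x, flipAt f x) ∉ U}).ncard = A.ncard := by
      rw [Kdeg_eq_ncard_good]
      exact Set.ncard_inter_add_ncard_sdiff_eq_ncard A {x | (x, flipAt f x) ∈ U} hAfin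
    have hbad := ncard_slice_bad_le hU f
    have h3 : A.ncard ≤ 2 * ({e ∈ wBdry ω U | e.1.2 = f}).ncard := by omega
    have h4 : (A.ncard : ℝ) ≤ 2 * (({e ∈ wBdry ω U | e.1.2 = f}).ncard : ℝ) := by
      exact_mod_cast h3
    exact h4.trans (by gcongr)

theorem ncard_eq_sum_fiber {α β : Type*} [DecidableEq β] {s : Set α} (hs : s.Finite) (g : α → β)
    (t : Finset β) (h : ∀ a ∈ s, g a ∈ t) :
    s.ncard = ∑ b ∈ t, ({a ∈ s | g a = b}).ncard := by
  classical
  rw [Set.ncard_eq_toFinset_card s hs, Finset.card_eq_sum_card_fiberwise (f := g) (t := t)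
    (fun a ha => h a (hs.mem_toFinset.1 ha))]
  refine Finset.sum_congr rfl fun b _ => ?_
  rw [← Set.ncard_coe_finset]
  congr 1
  ext a
  simp

theorem ncard_nonsatisfiable_le {d : ℕ} {ω : Config d} {n : ℕ} {k : ℝ} (hk : 2 ≤ k)
    {U : Set (Lamp d)} (hU : U ⊆ wVert (clusterN ω n)) :
    (({u ∈ U | (Kdeg U u.2 : ℝ≥0∞) < FolC ω n k / 3}).ncard : ℝ) ≤
      k * ((wBdry ω U).ncard : ℝ) := by
  classical
  have hfin := wVert_finite_of_subset hU
  set T : Finset (Zd d →₀ ZMod 2) := hfin.toFinset.image Prod.snd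
  have hT : ∀ u ∈ U, u.2 ∈ T := fun u hu =>
    Finset.mem_image_of_mem _ (hfin.mem_toFinset.2 hu)
  rw [ncard_eq_sum_fiber (hfin.subset (Set.sep_subset _ _)) Prod.snd T fun u hu => hT u hu.1,
    ncard_eq_sum_fiber (wBdry_finite hU) (fun e => e.1.2) T fun e he => hT e.1 he.1]
  push_cast
  rw [Finset.mul_sum]
  refine Finset.sum_le_sum fun f _ => ?_
  by_cases hf : (Kdeg U f : ℝ≥0∞) < FolC ω n k / 3
  · refine le_trans ?_ (ncard_slice_le_of_Kdeg_lt hk hU hf)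
    have hle : ({u ∈ {u ∈ U | (Kdeg U u.2 : ℝ≥0∞) < FolC ω n k / 3} | u.2 = f}).ncard ≤
        ({x | (x, f) ∈ U}).ncard := by
      refine Set.ncard_le_ncard_of_injOn Prod.fst ?_ ?_
        (hfin.preimage (fun _ _ _ _ h => congrArg Prod.fst h))
      · rintro ⟨x, g⟩ ⟨⟨h1, -⟩, rfl⟩
        exact h1
      · rintro ⟨x, g⟩ ⟨-, h1⟩ ⟨y, g'⟩ ⟨-, h2⟩ h
        exact Prod.ext h (h1.trans h2.symm)
    exact_mod_cast hle
  · have hempty : {u ∈ {u ∈ U | (Kdeg U u.2 : ℝ≥0∞) < FolC ω n k / 3} | u.2 = f} = ∅ := by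
      rw [Set.eq_empty_iff_forall_notMem]
      rintro u ⟨⟨-, h1⟩, rfl⟩
      exact hf h1
    rw [hempty, Set.ncard_empty]
    push_cast
    positivity

/-- few bad points and few non-satisfiable points. -/
theorem stmt4 (d : ℕ) (hd : 2 ≤ d) (ω : Config d) (n : ℕ) (k : ℝ) (hk : 2 ≤ k)
    (U : Set (Lamp d)) (hU : U ⊆ wVert (clusterN ω n)) (hUne : U.Nonempty)
    (hsmall : ((wBdry ω U).ncard : ℝ) / (U.ncard : ℝ) ≤ 1 / (1000 * k)) :
    (({u ∈ U | badPt U u}).ncard : ℝ) / (U.ncard : ℝ) ≤ 1 / (1000 * k) ∧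
      (({u ∈ U | (Kdeg U u.2 : ℝ≥0∞) < FolC ω n k / 3}).ncard : ℝ) / (U.ncard : ℝ)
        ≤ 1 / 500 := by
  have hpos : (0 : ℝ) < U.ncard := by
    exact_mod_cast (Set.ncard_pos (wVert_finite_of_subset hU)).2 hUne
  refine ⟨le_trans ?_ hsmall, ?_⟩
  · have h := ncard_bad_le hU
    gcongr
  · have h := ncard_nonsatisfiable_le hk hU
    rw [div_le_div_iff₀ hpos (by positivity)] at hsmall ⊢
    linarith

end Perco
end

section
/- Let b > 0 and let K be a finite graph with E(K) ≠ ∅. Call a vertex of K b-satisfiable if at least b edges of K are attached to it, and call an edge b-non-satisfiable if it does not join two b-satisfiable vertices. If the number of b-non-satisfiable edges of K is strictly less than |E(K)|/2, then there exists a nonempty subgraph K' of K in which every vertex is b/3-satisfiable, i.e. every vertex of K' has degree at least b/3 in K'. -/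
open MeasureTheory
open scoped ENNReal

namespace Perco

open Classical in
/-- A graph with more than `c` edges inside `S` per vertex of `S` has a nonempty subgraph in which
every degree is at least `c`. -/
theorem exists_subgraph_le_degree {V : Type*} [Fintype V] (K : SimpleGraph V) (c : ℝ)
    (S : Finset V)
    (hS : c * (S.card : ℝ) < ({e ∈ K.edgeFinset | ∀ v ∈ e, v ∈ S}.card : ℝ)) :
    ∃ K' : K.Subgraph, K'.verts.Nonempty ∧
      ∀ v ∈ K'.verts, c ≤ ((K'.neighborSet v).ncard : ℝ) := by
  obtain ⟨T, -, hT⟩ := exists_minimal_le_of_wellFoundedLT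
    (fun T : Finset V => c * (T.card : ℝ) < ({e ∈ K.edgeFinset | ∀ v ∈ e, v ∈ T}.card : ℝ)) S hS
  have hTc := hT.prop
  refine ⟨(⊤ : K.Subgraph).induce T, ?_, fun v hv => ?_⟩
  · rw [SimpleGraph.Subgraph.induce_verts, Finset.coe_nonempty, Finset.nonempty_iff_ne_empty]
    rintro rfl
    have hempty : {e ∈ K.edgeFinset | ∀ v ∈ e, v ∈ (∅ : Finset V)} = ∅ :=
      Finset.filter_eq_empty_iff.2 fun e _ he => absurd (he _ e.out_fst_mem) (Finset.notMem_empty _)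
    rw [hempty] at hTc
    simp at hTc
  · have hv : v ∈ T := hv
    have herase := hT.not_prop_of_lt (Finset.erase_ssubset hv)
    have hcard : ((T.erase v).card : ℝ) + 1 = T.card := mod_cast Finset.card_erase_add_one hv
    set N := ((⊤ : K.Subgraph).induce (T : Set V)).neighborSet v with hN
    have hsub : {e ∈ K.edgeFinset | ∀ w ∈ e, w ∈ T} ⊆
        {e ∈ K.edgeFinset | ∀ w ∈ e, w ∈ T.erase v} ∪ N.toFinset.image (fun y => s(v, y)) := by
      intro e he
      simp only [Finset.mem_filter, SimpleGraph.mem_edgeFinset] at he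
      by_cases hve : v ∈ e
      · obtain ⟨y, rfl⟩ := hve
        refine Finset.mem_union_right _ (Finset.mem_image_of_mem _ ?_)
        simp only [hN, Set.mem_toFinset, SimpleGraph.Subgraph.mem_neighborSet,
          SimpleGraph.Subgraph.induce_adj, SimpleGraph.Subgraph.top_adj, Finset.mem_coe]
        exact ⟨hv, he.2 y (Sym2.mem_mk_right v y), he.1⟩
      · refine Finset.mem_union_left _ ?_
        simp only [Finset.mem_filter, SimpleGraph.mem_edgeFinset, Finset.mem_erase]
        exact ⟨he.1, fun w hw => ⟨fun h => hve (h ▸ hw), he.2 w hw⟩⟩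
    have hle := (Finset.card_le_card hsub).trans
      ((Finset.card_union_le _ _).trans (Nat.add_le_add_left Finset.card_image_le _))
    rw [← Set.ncard_eq_toFinset_card'] at hle
    have hle : ({e ∈ K.edgeFinset | ∀ w ∈ e, w ∈ T}.card : ℝ) ≤
      {e ∈ K.edgeFinset | ∀ w ∈ e, w ∈ T.erase v}.card + N.ncard := mod_cast hle
    rw [← hcard] at hTc
    linarith

open Classical in
/-- In the sum of the degrees over `S`, edges inside `S` count twice and other edges at most
once. -/
theorem sum_degree_le {V : Type*} [Fintype V] (K : SimpleGraph V) (S : Finset V) :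
    ∑ v ∈ S, K.degree v ≤
      2 * {e ∈ K.edgeFinset | ∀ v ∈ e, v ∈ S}.card +
        {e ∈ K.edgeFinset | ¬ ∀ v ∈ e, v ∈ S}.card := by
  have hcount : ∑ v ∈ S, K.degree v = ∑ e ∈ K.edgeFinset, {v ∈ S | v ∈ e}.card := by
    simp only [← K.card_incidenceFinset_eq_degree, SimpleGraph.incidenceFinset_eq_filter]
    exact Finset.sum_card_bipartiteAbove_eq_sum_card_bipartiteBelow (fun v e => v ∈ e)
  rw [hcount, ← Finset.sum_filter_add_sum_filter_not K.edgeFinset (fun e => ∀ v ∈ e, v ∈ S),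
    mul_comm, ← smul_eq_mul]
  refine add_le_add (Finset.sum_le_card_nsmul _ _ _ fun e _ => ?_) ?_
  · have : {v ∈ S | v ∈ e} ⊆ e.toFinset := fun v hv => by simp_all
    refine (Finset.card_le_card this).trans ?_
    induction e with | _ x y => simpa [Sym2.toFinset_mk_eq] using Finset.card_le_two (a := x) (b := y)
  · rw [← mul_one (Finset.card _), ← smul_eq_mul]
    refine Finset.sum_le_card_nsmul _ _ _ fun e he => ?_
    simp only [Finset.mem_filter, not_forall] at he
    obtain ⟨-, w, ⟨y, rfl⟩, hwS⟩ := he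
    refine (Finset.card_le_card (t := {y}) fun v hv => ?_).trans
      (Finset.card_singleton y).le
    simp only [Finset.mem_filter, Sym2.mem_iff] at hv
    rcases hv.2 with rfl | rfl
    · exact absurd hv.1 hwS
    · simp

/-- extraction of a subgraph all of whose vertices are `b/3`-satisfiable. -/
theorem stmt5 {V : Type*} [Fintype V] (K : SimpleGraph V) (b : ℝ) (hb : 0 < b)
    (hE : K.edgeSet.Nonempty)
    (hNS : ((K.edgeSet \ {e | ∀ v ∈ e, b ≤ ((K.neighborSet v).ncard : ℝ)}).ncard : ℝ)
        < (K.edgeSet.ncard : ℝ) / 2) :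
    ∃ K' : K.Subgraph, K'.verts.Nonempty ∧
      ∀ v ∈ K'.verts, b / 3 ≤ ((K'.neighborSet v).ncard : ℝ) := by
  classical
  set S : Finset V := {v | b ≤ ((K.neighborSet v).ncard : ℝ)} with hSdef
  have hmem (v : V) : b ≤ ((K.neighborSet v).ncard : ℝ) ↔ v ∈ S := by simp [hSdef]
  have hdeg (v : V) : (K.neighborSet v).ncard = K.degree v := by
    rw [Set.ncard_eq_toFinset_card', Set.toFinset_card, K.card_neighborSet_eq_degree]
  have hbad : K.edgeSet \ {e | ∀ v ∈ e, b ≤ ((K.neighborSet v).ncard : ℝ)} =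
      ({e ∈ K.edgeFinset | ¬ ∀ v ∈ e, v ∈ S} : Finset (Sym2 V)) := by
    ext e
    simp only [hmem, Set.mem_sdiff, Set.mem_ofPred_eq, Finset.coe_filter,
      SimpleGraph.mem_edgeFinset]
  rw [hbad, Set.ncard_coe_finset, ← K.coe_edgeFinset, Set.ncard_coe_finset] at hNS
  have hsum : b * (S.card : ℝ) ≤ ∑ v ∈ S, (K.degree v : ℝ) := by
    rw [mul_comm, ← nsmul_eq_mul]
    exact Finset.card_nsmul_le_sum _ _ _ fun v hv => hdeg v ▸ (hmem v).2 hv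
  have hle : ∑ v ∈ S, (K.degree v : ℝ) ≤
      2 * {e ∈ K.edgeFinset | ∀ v ∈ e, v ∈ S}.card +
        {e ∈ K.edgeFinset | ¬ ∀ v ∈ e, v ∈ S}.card := mod_cast sum_degree_le K S
  have htot : ({e ∈ K.edgeFinset | ∀ v ∈ e, v ∈ S}.card : ℝ) +
      {e ∈ K.edgeFinset | ¬ ∀ v ∈ e, v ∈ S}.card = K.edgeFinset.card :=
    mod_cast Finset.card_filter_add_card_filter_not _
  exact exists_subgraph_le_degree K (b / 3) S (by linarith)

end Perco
end
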